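/- arXiv:2207.11331 — 4 statements merged into one kernel-verified Lean document; each statement's English description precedes it below -/
import Mathlib

section
/- Let α be the unique real root greater than 1 of the polynomial x³ − x − 1 (the plastic number). Then for every integer k ≥ 4, the Padovan number P_k satisfies α^{k−2} ≤ P_k ≤ α^{k−1}. -/
/-- The Padovan sequence: P 0 = P 1 = P 2 = 1 and P (k+3) = P (k+1) + P k. -/
def padovan : ℕ → ℕ
  | 0 => 1
  | 1 => 1
  | 2 => 1
  | k + 3 => padovan (k + 1) + padovan k

/-- If `α` is the (unique) real root greater than `1` of `x³ - x - 1`, then for every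
integer `k ≥ 4` the Padovan number `P k` satisfies `α^(k-2) ≤ P k ≤ α^(k-1)`. -/
theorem padovan_bounds (α : ℝ) (hroot : α ^ 3 = α + 1) (hα : 1 < α) :
    ∀ k : ℕ, 4 ≤ k → α ^ (k - 2) ≤ (padovan k : ℝ) ∧ (padovan k : ℝ) ≤ α ^ (k - 1) := by
  have h1 : (1.32:ℝ) ≤ α := by
    by_contra h
    push Not at h
    nlinarith [mul_pos (sub_pos.2 hα) (sub_pos.2 h), sq_nonneg (α - 1)]
  have h2 : α ≤ (1.33:ℝ) := by
    by_contra h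
    push Not at h
    nlinarith [mul_pos (sub_pos.2 hα) (sub_pos.2 h), sq_nonneg (α - 1)]
  have key : ∀ n : ℕ, α ^ (n + 2) ≤ (padovan (n + 4) : ℝ) ∧
      (padovan (n + 4) : ℝ) ≤ α ^ (n + 3) := by
    intro n
    induction n using Nat.strong_induction_on with
    | _ n ih =>
      match n, ih with
      | 0, _ =>
        norm_num [padovan]
        constructor <;> nlinarith
      | 1, _ =>
        have e : α ^ 4 = α ^ 2 + α := by linear_combination α * hroot
        norm_num [padovan]
        constructor <;> nlinarith
      | 2, _ =>
        have e : α ^ 4 = α ^ 2 + α := by linear_combination α * hroot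
        have e' : α ^ 5 = α ^ 2 + α + 1 := by linear_combination (α ^ 2 + 1) * hroot
        norm_num [padovan]
        constructor <;> nlinarith
      | m + 3, ih =>
        obtain ⟨a1, a2⟩ := ih m (by omega)
        obtain ⟨b1, b2⟩ := ih (m + 1) (by omega)
        have hp : padovan (m + 3 + 4) = padovan (m + 1 + 4) + padovan (m + 4) := rfl
        have e1 : α ^ (m + 3 + 2) = α ^ (m + 1 + 2) + α ^ (m + 2) := by
          linear_combination α ^ (m + 2) * hroot
        have e2 : α ^ (m + 3 + 3) = α ^ (m + 1 + 3) + α ^ (m + 3) := by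
          linear_combination α ^ (m + 3) * hroot
        rw [hp, e1, e2]
        push_cast
        constructor <;> linarith
  intro k hk
  obtain ⟨n, rfl⟩ := Nat.exists_eq_add_of_le' hk
  exact key n
end

section
/- Let δ = (1+√5)/2, let α be the unique real root greater than 1 of x³ − x − 1, and let a = (1+α)/(−α² + 3α + 1). Then for all positive integers n and m, δⁿ ≠ √5 · a · αᵐ. -/
open Polynomial IntermediateField in
theorem sqrt5_not_mem_aux (α : ℝ) (hαroot : α ^ 3 = α + 1) : Real.sqrt 5 ∉ ℚ⟮α⟯ := by
  intro h
  have hirr : Irreducible (X ^ 3 - X - 1 : ℚ[X]) := X_pow_sub_X_sub_one_irreducible_rat (by norm_num)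
  have hdeg : (X ^ 3 - X - 1 : ℚ[X]).natDegree = 3 := by compute_degree!
  have hmon : (X ^ 3 - X - 1 : ℚ[X]).Monic := by monicity!
  have hev : aeval α (X ^ 3 - X - 1 : ℚ[X]) = 0 := by simp [hαroot]
  have hint : IsIntegral ℚ α := ⟨_, hmon, hev⟩
  have hmin := minpoly.eq_of_irreducible_of_monic hirr hev hmon
  have hfr : Module.finrank ℚ ℚ⟮α⟯ = 3 := by
    rw [IntermediateField.adjoin.finrank hint, ← hmin, hdeg]
  have : FiniteDimensional ℚ ℚ⟮α⟯ := IntermediateField.adjoin.finiteDimensional hint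
  let s : ℚ⟮α⟯ := ⟨_, h⟩
  have hs : s ^ 2 = 5 := by
    apply Subtype.ext
    change (Real.sqrt 5) ^ 2 = 5
    norm_num
  have hsi : IsIntegral ℚ s := IsIntegral.of_finite ℚ s
  have hd := minpoly.degree_dvd hsi
  rw [hfr] at hd
  have hm2 : (X ^ 2 - 5 : ℚ[X]).Monic := by monicity!
  have hn2 : (X ^ 2 - 5 : ℚ[X]).natDegree = 2 := by compute_degree!
  have hle : (minpoly ℚ s).natDegree ≤ (X ^ 2 - 5 : ℚ[X]).natDegree :=
    Polynomial.natDegree_le_of_dvd (minpoly.dvd _ _ (by rw [map_sub, map_pow, aeval_X, hs, map_ofNat, sub_self])) hm2.ne_zero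
  rw [hn2] at hle
  have h1 : (minpoly ℚ s).natDegree = 1 := by
    rcases (Nat.dvd_prime Nat.prime_three).1 hd with h | h <;> omega
  obtain ⟨q, hq⟩ := minpoly.natDegree_eq_one_iff.1 h1
  have hq' : (q : ℝ) = Real.sqrt 5 := by
    have := congrArg (fun x : ℚ⟮α⟯ => (x : ℝ)) hq
    simpa [s] using this
  have hirr5 : Irrational (Real.sqrt 5) := by
    simpa using Nat.Prime.irrational_sqrt (p := 5) (by norm_num)
  exact hirr5 ⟨q, hq'⟩

theorem pow_form_aux (n : ℕ) : ∃ p q : ℚ, 0 < p ∧ 0 < q ∧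
    ((1 + Real.sqrt 5) / 2) ^ (n + 1) = (p : ℝ) + q * Real.sqrt 5 := by
  have h5 : Real.sqrt 5 ^ 2 = 5 := by norm_num
  induction n with
  | zero => exact ⟨1/2, 1/2, by norm_num, by norm_num, by push_cast; ring⟩
  | succ k ih =>
    obtain ⟨p, q, hp, hq, h⟩ := ih
    refine ⟨(p + 5 * q) / 2, (p + q) / 2, by positivity, by positivity, ?_⟩
    rw [pow_succ, h]
    push_cast
    linear_combination (q : ℝ) / 2 * h5

/-- Let `δ = (1+√5)/2`, let `α` be the real root greater than `1` of `x³ - x - 1`, and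
`a = (1+α)/(-α² + 3α + 1)`. Then `δ^n ≠ √5·a·α^m` for all positive integers `n, m`. -/
theorem lambda_ne_zero (δ α a : ℝ) (hδ : δ = (1 + Real.sqrt 5) / 2)
    (hαroot : α ^ 3 = α + 1) (hα : 1 < α)
    (ha : a = (1 + α) / (-α ^ 2 + 3 * α + 1)) :
    ∀ n m : ℕ, 0 < n → 0 < m → δ ^ n ≠ Real.sqrt 5 * a * α ^ m := by
  intro n m hn _ h
  obtain ⟨k, rfl⟩ : ∃ k, n = k + 1 := ⟨n - 1, by omega⟩
  obtain ⟨p, q, hp, hq, hpq⟩ := pow_form_aux k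
  rw [hδ, hpq] at h
  apply sqrt5_not_mem_aux α hαroot
  let K := IntermediateField.adjoin ℚ {α}
  have hαK : α ∈ K := IntermediateField.mem_adjoin_simple_self ℚ α
  have haK : a ∈ K := by
    rw [ha]
    have h3 : (3 : ℝ) ∈ K := ofNat_mem K 3
    exact K.div_mem (K.add_mem K.one_mem hαK) (K.add_mem (K.add_mem
      (K.neg_mem (pow_mem hαK 2)) (K.mul_mem h3 hαK)) K.one_mem)
  have hz : a * α ^ m ∈ K := K.mul_mem haK (pow_mem hαK m)
  have hrat : ∀ r : ℚ, (r : ℝ) ∈ K := fun r => K.algebraMap_mem r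
  have hp' : (p : ℝ) ≠ 0 := by exact_mod_cast hp.ne'
  have hmul : Real.sqrt 5 * (a * α ^ m - q) = p := by linear_combination -h
  have hne : a * α ^ m - q ≠ 0 := by
    intro h0
    rw [h0, mul_zero] at hmul
    exact hp' hmul.symm
  have : Real.sqrt 5 = p / (a * α ^ m - q) := by
    rw [eq_div_iff hne, hmul]
  rw [this]
  exact K.div_mem (hrat p) (K.sub_mem hz (hrat q))
end

section
/- Let δ = (1+√5)/2, let α be the unique real root greater than 1 of x³ − x − 1, and let a = (1+α)/(−α² + 3α + 1). Then for all positive integers n > n₁ and m, δⁿ − δ^{n₁} ≠ √5 · a · αᵐ. -/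
def abSeq : ℕ → ℚ × ℚ
  | 0 => (1/2, 1/2)
  | k+1 => (((abSeq k).1 + 5 * (abSeq k).2) / 2, ((abSeq k).1 + (abSeq k).2) / 2)

lemma abSeq_pos (k : ℕ) : 0 < (abSeq k).1 ∧ 0 < (abSeq k).2 ∧ (abSeq k).1 < 5 * (abSeq k).2 := by
  induction k with
  | zero => norm_num [abSeq]
  | succ k ih =>
    obtain ⟨h1, h2, h3⟩ := ih
    simp only [abSeq]
    refine ⟨by linarith, by linarith, by linarith⟩

lemma abSeq_mono : StrictMono (fun k => (abSeq k).1) := by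
  refine strictMono_nat_of_lt_succ fun k => ?_
  obtain ⟨h1, h2, h3⟩ := abSeq_pos k
  simp only [abSeq]
  linarith

lemma abSeq_pow (k : ℕ) :
    ((1 + Real.sqrt 5) / 2) ^ (k+1) = ((abSeq k).1 : ℝ) + (abSeq k).2 * Real.sqrt 5 := by
  induction k with
  | zero => simp only [abSeq]; push_cast; ring
  | succ k ih =>
    have h5 : Real.sqrt 5 * Real.sqrt 5 = 5 := Real.mul_self_sqrt (by norm_num)
    rw [pow_succ, ih]
    simp only [abSeq]
    push_cast
    linear_combination ((abSeq k).2 : ℝ) / 2 * h5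

open Polynomial in
lemma rat_of_quadratic (α x : ℝ) (hα : α ^ 3 = α + 1) (hx : x ∈ IntermediateField.adjoin ℚ {α})
    (u v : ℚ) (h : x = u + v * Real.sqrt 5) : ∃ r : ℚ, x = r := by
  have h5 : Real.sqrt 5 * Real.sqrt 5 = 5 := Real.mul_self_sqrt (by norm_num)
  have hirr : Irreducible (X ^ 3 - X - 1 : ℚ[X]) := X_pow_sub_X_sub_one_irreducible_rat (by norm_num)
  have hmon : (X ^ 3 - X - 1 : ℚ[X]).Monic := by monicity!
  have hdeg : (X ^ 3 - X - 1 : ℚ[X]).natDegree = 3 := by compute_degree!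
  have hroot : aeval α (X ^ 3 - X - 1 : ℚ[X]) = 0 := by simp [hα]
  have hint : IsIntegral ℚ α := ⟨_, hmon, by simpa [aeval_def] using hroot⟩
  have hmin := minpoly.eq_of_irreducible_of_monic hirr hroot hmon
  have hfr : Module.finrank ℚ (IntermediateField.adjoin ℚ {α}) = 3 := by
    rw [IntermediateField.adjoin.finrank hint, ← hmin, hdeg]
  haveI : FiniteDimensional ℚ (IntermediateField.adjoin ℚ {α}) :=
    IntermediateField.adjoin.finiteDimensional hint
  have hd : (minpoly ℚ (⟨x, hx⟩ : IntermediateField.adjoin ℚ {α})).natDegree ∣ 3 := by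
    rw [← hfr]
    exact minpoly.degree_dvd (Algebra.IsIntegral.isIntegral _)
  have heq : minpoly ℚ (⟨x, hx⟩ : IntermediateField.adjoin ℚ {α}) = minpoly ℚ x :=
    (minpoly.algebraMap_eq (algebraMap (IntermediateField.adjoin ℚ {α}) ℝ).injective _).symm
  rw [heq] at hd
  have hq : aeval x (X ^ 2 - C (2 * u) * X + C (u ^ 2 - 5 * v ^ 2) : ℚ[X]) = 0 := by
    simp [h]
    linear_combination (v : ℝ) ^ 2 * h5
  have hqd : (X ^ 2 - C (2 * u) * X + C (u ^ 2 - 5 * v ^ 2) : ℚ[X]).natDegree = 2 := by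
    compute_degree!
  have hle := natDegree_le_of_dvd (minpoly.dvd ℚ x hq) (by
    intro h0; rw [h0] at hqd; simp at hqd)
  rw [hqd] at hle
  have h1 : (minpoly ℚ x).natDegree = 1 := by
    rcases (Nat.dvd_prime Nat.prime_three).1 hd with h | h
    · exact h
    · omega
  obtain ⟨r, hr⟩ := minpoly.natDegree_eq_one_iff.1 h1
  exact ⟨r, by simpa using hr.symm⟩


/-- Let `δ = (1+√5)/2`, let `α` be the real root greater than `1` of `x³ - x - 1`, and
`a = (1+α)/(-α² + 3α + 1)`. Then `δ^n - δ^n₁ ≠ √5·a·α^m` for all positive integers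
`n > n₁` and `m`. -/
theorem lambda₁_ne_zero (δ α a : ℝ) (hδ : δ = (1 + Real.sqrt 5) / 2)
    (hαroot : α ^ 3 = α + 1) (hα : 1 < α)
    (ha : a = (1 + α) / (-α ^ 2 + 3 * α + 1)) :
    ∀ n n₁ m : ℕ, 0 < n₁ → n₁ < n → 0 < m →
      δ ^ n - δ ^ n₁ ≠ Real.sqrt 5 * a * α ^ m := by
  intro n n₁ m h0 h1 _ he
  obtain ⟨k, rfl⟩ : ∃ k, n = k + 1 := ⟨n - 1, by omega⟩
  obtain ⟨l, rfl⟩ : ∃ l, n₁ = l + 1 := ⟨n₁ - 1, by omega⟩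
  have hlt : (abSeq l).1 < (abSeq k).1 := abSeq_mono (by omega)
  have h5 : Real.sqrt 5 * Real.sqrt 5 = 5 := Real.mul_self_sqrt (by norm_num)
  have h5n : Real.sqrt 5 ≠ 0 := by positivity
  rw [hδ, abSeq_pow, abSeq_pow] at he
  have hαm : α ∈ IntermediateField.adjoin ℚ {α} := IntermediateField.mem_adjoin_simple_self ℚ α
  have hone := one_mem (IntermediateField.adjoin ℚ {α})
  have hthree : (3 : ℝ) ∈ IntermediateField.adjoin ℚ {α} := ofNat_mem _ 3
  have hx : a * α ^ m ∈ IntermediateField.adjoin ℚ {α} := by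
    rw [ha]
    exact mul_mem (div_mem (add_mem hone hαm)
      (add_mem (add_mem (neg_mem (pow_mem hαm 2)) (mul_mem hthree hαm)) hone)) (pow_mem hαm m)
  obtain ⟨r, hr⟩ := rat_of_quadratic α _ hαroot hx ((abSeq k).2 - (abSeq l).2)
    (((abSeq k).1 - (abSeq l).1) / 5) (by
      apply mul_left_cancel₀ h5n
      push_cast
      linear_combination -he - (((abSeq k).1 : ℝ) - (abSeq l).1) / 5 * h5)
  rw [mul_assoc, hr] at he
  have hirr : Irrational (Real.sqrt 5) := by
    simpa using Nat.Prime.irrational_sqrt (show Nat.Prime 5 by norm_num)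
  have key : ((((abSeq k).1 - (abSeq l).1 : ℚ)) : ℝ)
      = ((r - (abSeq k).2 + (abSeq l).2 : ℚ) : ℝ) * Real.sqrt 5 := by
    push_cast
    linear_combination he
  by_cases hs : r - (abSeq k).2 + (abSeq l).2 = 0
  · rw [hs] at key
    simp only [Rat.cast_zero, zero_mul, Rat.cast_eq_zero] at key
    linarith
  · exact (hirr.ratCast_mul hs).ne_rat _ key.symm
end

section
/- (Baker–Davenport reduction) Let τ be an irrational real number, M a positive integer, and p/q a rational number (p an integer, q a positive integer) with q > 6M and |qτ − p| < 1/q. Let A > 0, B > 1 and μ be real numbers, and set ε = ‖μq‖ − M·‖τq‖, where ‖x‖ denotes the distance from x to the nearest integer. If ε > 0, then there is no solution of the inequality 0 < mτ − n + μ < A·B^{−k} in positive integers m, n, k with m ≤ M and k ≥ log(Aq/ε)/log B. -/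
/-- Distance from a real number to the nearest integer. -/
noncomputable def distNearestInt (x : ℝ) : ℝ := |x - round x|

/-- (Baker–Davenport reduction.) Let `τ` be irrational, `M` a positive integer,
`p/q` a rational with `q > 6M` and `|qτ - p| < 1/q`. Let `A > 0`, `B > 1`, `μ` be
reals, and `ε = ‖μq‖ - M‖τq‖` where `‖·‖` is the distance to the nearest integer.
If `ε > 0`, then there is no solution of `0 < mτ - n + μ < A·B^(-k)` in positive
integers `m, n, k` with `m ≤ M` and `k ≥ log(Aq/ε)/log B`. -/
theorem baker_davenport (τ : ℝ) (hτ : Irrational τ) (M : ℕ) (hM : 0 < M)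
    (p : ℤ) (q : ℕ) (hq : 0 < q) (hqM : 6 * M < q)
    (hpq : |(q : ℝ) * τ - (p : ℝ)| < 1 / (q : ℝ))
    (A B μ : ℝ) (hA : 0 < A) (hB : 1 < B)
    (ε : ℝ) (hε : ε = distNearestInt (μ * q) - (M : ℝ) * distNearestInt (τ * q))
    (hε0 : 0 < ε) :
    ¬ ∃ m n k : ℕ, 0 < m ∧ 0 < n ∧ 0 < k ∧ m ≤ M ∧
        Real.log (A * q / ε) / Real.log B ≤ (k : ℝ) ∧
        0 < (m : ℝ) * τ - (n : ℝ) + μ ∧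
        (m : ℝ) * τ - (n : ℝ) + μ < A * B ^ (-(k : ℤ)) := by
  rintro ⟨m, n, k, -, -, -, hmM, hk, h0, h1⟩
  have hqR : (0 : ℝ) < q := by exact_mod_cast hq
  have hB0 : 0 < B := by linarith
  have hmR : (m : ℝ) ≤ M := by exact_mod_cast hmM
  have hlB : 0 < Real.log B := Real.log_pos hB
  have hBk : 0 < B ^ k := pow_pos hB0 k
  -- the size condition on `k`
  have h2 : A * q / ε ≤ B ^ k := by
    rw [div_le_iff₀ hlB, ← Real.log_pow] at hk
    exact (Real.log_le_log_iff (by positivity) hBk).1 hk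
  rw [div_le_iff₀ hε0] at h2
  rw [zpow_neg, zpow_natCast, ← div_eq_mul_inv, lt_div_iff₀ hBk] at h1
  -- hence `q * (m τ - n + μ) < ε`
  have h3 : q * ((m : ℝ) * τ - n + μ) < ε := by
    have h4 : (q * ((m : ℝ) * τ - n + μ)) * B ^ k < ε * B ^ k := by nlinarith
    exact lt_of_mul_lt_mul_right h4 hBk.le
  have h5 : 0 < q * ((m : ℝ) * τ - n + μ) := mul_pos hqR h0
  have h6 := round_le (μ * q) ((n : ℤ) * q - m * round (τ * q))
  have h7 : μ * q - (((n : ℤ) * q - m * round (τ * q) : ℤ) : ℝ)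
      = q * ((m : ℝ) * τ - n + μ) - m * (τ * q - round (τ * q)) := by
    push_cast; ring
  rw [h7] at h6
  have h8 := abs_sub (q * ((m : ℝ) * τ - n + μ)) (m * (τ * q - round (τ * q)))
  rw [abs_of_pos h5, abs_mul, Nat.abs_cast] at h8
  have h9 := mul_le_mul_of_nonneg_right hmR (abs_nonneg (τ * q - round (τ * q)))
  unfold distNearestInt at hε
  linarith
end
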